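/- arXiv:2406.17121 — 5 statements merged into one kernel-verified Lean document; each statement's English description precedes it below -/
import Mathlib

section
/- (FlushAll is (2−r)/(1−r)-competitive in the discrete k-wallet model.) Let C, T > 0 be reals, k ≥ 1 an integer, F ≥ 1 an integer flush period, and set r = kT/C; assume r < 1. Then there is a constant c₀ ≥ 0 depending only on C, T, k, F (but not on n or the transaction sequence) such that for every n and every transaction sequence tx of length n with maximum transaction size T, OPT_D(C,k;tx) ≤ ((2−r)/(1−r)) · V_FA(tx) + c₀. -/
open Finset

noncomputable section

/-! ### The discrete `k`-wallet model -/

/-- Wallet `i` is offline at time `t`: some flush time `t' ∈ Φ i` satisfies `t' < t ≤ t' + F`. -/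
def WalletOffline (F : ℕ) (Φ : ℕ → Finset ℕ) (i t : ℕ) : Prop :=
  ∃ t' ∈ Φ i, t' < t ∧ t ≤ t' + F

/-- A feasible execution in the discrete `k`-wallet model with integer flush period `F`,
total collateral `C` (each wallet has size `C / k`), over time slots `1,…,n`, on the
transaction sequence `tx`.  It consists of a settlement assignment
`s : ℕ → Option ℕ` (wallet indices are `0,…,k-1`) and flush-time sets `Φ i`.
Whenever `s t = some i`, wallet `i` must be online at `t` and the total value settled in
wallet `i` since the wallet's last flush strictly before `t` (including `tx t`) is at
most `C / k`. -/
def DFeasible (F : ℕ) (C : ℝ) (k n : ℕ) (tx : ℕ → ℝ)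
    (s : ℕ → Option ℕ) (Φ : ℕ → Finset ℕ) : Prop :=
  (∀ i, Φ i ⊆ Finset.Icc 1 n) ∧
  (∀ t i, s t = some i → i < k ∧ t ∈ Finset.Icc 1 n) ∧
  (∀ t i, s t = some i →
    ¬ WalletOffline F Φ i t ∧
    (∑ t' ∈ (Finset.Icc 1 t).filter
        (fun t' => s t' = some i ∧ ∀ u ∈ Φ i, ¬ (t' ≤ u ∧ u < t)), tx t') ≤ C / k)

/-- The total value settled by an execution with settlement assignment `s`. -/
def DValue (n : ℕ) (tx : ℕ → ℝ) (s : ℕ → Option ℕ) : ℝ :=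
  ∑ t ∈ (Finset.Icc 1 n).filter (fun t => (s t).isSome), tx t

/-! ### The `FlushAll` algorithm -/

/-- The state of the `FlushAll` algorithm: remaining wallet capacities, the time until which
all wallets are offline (inclusive), and the total value settled so far. -/
structure FAState where
  cap : ℕ → ℝ
  offlineUntil : ℕ
  settled : ℝ

/-- One step of `FlushAll` (with `k` wallets of size `C / k` and flush period `F`) at time
`t` on a transaction of value `v`: if the wallets are offline, discard; else settle in the
least-index wallet that fits, if any; otherwise discard and flush all wallets. -/
def faStep (C : ℝ) (k F : ℕ) (st : FAState) (t : ℕ) (v : ℝ) : FAState :=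
  if t ≤ st.offlineUntil then st
  else if h : ∃ i, i < k ∧ v ≤ st.cap i then
    let i := Nat.find h
    { st with cap := fun j => if j = i then st.cap i - v else st.cap j,
              settled := st.settled + v }
  else
    { cap := fun _ => C / k, offlineUntil := t + F, settled := st.settled }

/-- The state of `FlushAll` after processing `tx 1, …, tx n`. -/
def faRun (C : ℝ) (k F n : ℕ) (tx : ℕ → ℝ) : FAState :=
  (List.range n).foldl (fun st j => faStep C k F st (j + 1) (tx (j + 1)))
    { cap := fun _ => C / k, offlineUntil := 0, settled := 0 }

/-- `V_FA(tx)`: the total value settled by `FlushAll`. -/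
def VFA (C : ℝ) (k F n : ℕ) (tx : ℕ → ℝ) : ℝ := (faRun C k F n tx).settled

/-! ### The `FlushWhenFull` algorithm -/

/-- The state of `FlushWhenFull`: the active wallet's remaining capacity, a counter whose
value mod `k` is the active wallet, per-wallet offline deadlines, and the settled value. -/
structure FWFState where
  cap : ℝ
  active : ℕ
  offlineUntil : ℕ → ℕ
  settled : ℝ

/-- One step of `FlushWhenFull` (with `k` wallets of size `C / k` and flush period `F`). -/
def fwfStep (C : ℝ) (k F : ℕ) (st : FWFState) (t : ℕ) (v : ℝ) : FWFState :=
  if t ≤ st.offlineUntil (st.active % k) then st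
  else if v ≤ st.cap then { st with cap := st.cap - v, settled := st.settled + v }
  else
    { cap := C / k, active := st.active + 1,
      offlineUntil := fun j => if j = st.active % k then t + F else st.offlineUntil j,
      settled := st.settled }

/-- The state of `FlushWhenFull` after processing `tx 1, …, tx n`. -/
def fwfRun (C : ℝ) (k F n : ℕ) (tx : ℕ → ℝ) : FWFState :=
  (List.range n).foldl (fun st j => fwfStep C k F st (j + 1) (tx (j + 1)))
    { cap := C / k, active := 0, offlineUntil := fun _ => 0, settled := 0 }

/-- `V_FWF(tx)`: the total value settled by `FlushWhenFull`. -/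
def VFWF (C : ℝ) (k F n : ℕ) (tx : ℕ → ℝ) : ℝ := (fwfRun C k F n tx).settled

/-! ### The `FlushTwoWhenFull` algorithm -/

/-- The state of `FlushTwoWhenFull`: capacities of the two wallets of the active pair,
a counter whose value mod `k / 2` is the active pair, per-pair offline deadlines, and the
settled value. -/
structure FTWFState where
  cap1 : ℝ
  cap2 : ℝ
  active : ℕ
  offlineUntil : ℕ → ℕ
  settled : ℝ

/-- One step of `FlushTwoWhenFull` (with `k` wallets of size `C / k`, grouped into `k / 2`
pairs, and flush period `F`). -/
def ftwfStep (C : ℝ) (k F : ℕ) (st : FTWFState) (t : ℕ) (v : ℝ) : FTWFState :=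
  if t ≤ st.offlineUntil (st.active % (k / 2)) then st
  else if v ≤ st.cap1 then { st with cap1 := st.cap1 - v, settled := st.settled + v }
  else if v ≤ st.cap2 then { st with cap2 := st.cap2 - v, settled := st.settled + v }
  else
    { cap1 := C / k, cap2 := C / k, active := st.active + 1,
      offlineUntil := fun j => if j = st.active % (k / 2) then t + F else st.offlineUntil j,
      settled := st.settled }

/-- The state of `FlushTwoWhenFull` after processing `tx 1, …, tx n`. -/
def ftwfRun (C : ℝ) (k F n : ℕ) (tx : ℕ → ℝ) : FTWFState :=
  (List.range n).foldl (fun st j => ftwfStep C k F st (j + 1) (tx (j + 1)))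
    { cap1 := C / k, cap2 := C / k, active := 0, offlineUntil := fun _ => 0, settled := 0 }

/-- `V_FTWF(tx)`: the total value settled by `FlushTwoWhenFull`. -/
def VFTWF (C : ℝ) (k F n : ℕ) (tx : ℕ → ℝ) : ℝ := (ftwfRun C k F n tx).settled

/-! ### The general collateral model -/

/-- A feasible settled set in the general collateral model with collateral `C` and flush
period `F`: for every `t ∈ S`, the total settled value in the window `[t - F, t]` is at
most `C`. -/
def GFeasible (F : ℕ) (C : ℝ) (n : ℕ) (tx : ℕ → ℝ) (S : Finset ℕ) : Prop :=
  S ⊆ Finset.Icc 1 n ∧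
  ∀ t ∈ S, (∑ t' ∈ S.filter (fun t' => t - F ≤ t' ∧ t' ≤ t), tx t') ≤ C

/-- The total value of a settled set. -/
def GValue (tx : ℕ → ℝ) (S : Finset ℕ) : ℝ := ∑ t ∈ S, tx t

/-! ### The threshold algorithm `A_η` -/

/-- The state of the threshold algorithm `A_η`: available collateral `avail`,
committed-but-unflushed collateral `committed`, total settled value, number of flushes
performed, and `ret u` is the amount of flushed collateral returning to availability at
time `u`. -/
structure EtaState where
  avail : ℝ
  committed : ℝ
  settled : ℝ
  flushes : ℕ
  ret : ℕ → ℝ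

/-- One step of `A_η` (collateral `C`, threshold `η`, flush period `F`) at time `t` on a
transaction of value `v`: first any returning collateral is added back; the transaction is
settled iff the available collateral covers it; after settling, if the committed collateral
reaches `η C`, exactly `η C` is flushed, returning at time `t + F + 1`. -/
def etaStep (C η : ℝ) (F : ℕ) (st : EtaState) (t : ℕ) (v : ℝ) : EtaState :=
  let U := st.avail + st.ret t
  if v ≤ U then
    if η * C ≤ st.committed + v then
      { avail := U - v, committed := st.committed + v - η * C,
        settled := st.settled + v, flushes := st.flushes + 1,
        ret := fun u => if u = t + F + 1 then st.ret u + η * C else st.ret u }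
    else
      { avail := U - v, committed := st.committed + v,
        settled := st.settled + v, flushes := st.flushes, ret := st.ret }
  else { st with avail := U }

/-- The state of `A_η` after processing `tx 1, …, tx n`. -/
def etaRun (C η : ℝ) (F n : ℕ) (tx : ℕ → ℝ) : EtaState :=
  (List.range n).foldl (fun st j => etaStep C η F st (j + 1) (tx (j + 1)))
    { avail := C, committed := 0, settled := 0, flushes := 0, ret := fun _ => 0 }

/-- `V_{A_η}(tx)`: the total value settled by the threshold algorithm `A_η`. -/
def VEta (C η : ℝ) (F n : ℕ) (tx : ℕ → ℝ) : ℝ := (etaRun C η F n tx).settled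

/-- `f_{A_η}(tx)`: the number of flushes performed by the threshold algorithm `A_η`. -/
def fEta (C η : ℝ) (F n : ℕ) (tx : ℕ → ℝ) : ℕ := (etaRun C η F n tx).flushes

/-! ### The general collateral model with profit margin and flush cost -/

/-- A feasible execution in the general collateral model with collateral `C` and flush
period `F`: a settled set `S ⊆ {1,…,n}` and a list `L` of flush events `(tⱼ, aⱼ)` with
`tⱼ ∈ {1,…,n}` and `aⱼ > 0`, such that (i) at every time `t` the total amount flushed by
time `t` is at most the total value settled by time `t`, and (ii) for every `t ∈ S` the
total value settled by time `t` minus the total amount whose flush period has completed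
before `t` is at most `C`. -/
def PFeasible (F : ℕ) (C : ℝ) (n : ℕ) (tx : ℕ → ℝ) (S : Finset ℕ)
    (L : List (ℕ × ℝ)) : Prop :=
  S ⊆ Finset.Icc 1 n ∧
  (∀ e ∈ L, e.1 ∈ Finset.Icc 1 n ∧ 0 < e.2) ∧
  (∀ t : ℕ, ((L.filter (fun e => decide (e.1 ≤ t))).map Prod.snd).sum ≤
      ∑ t' ∈ S.filter (fun t' => t' ≤ t), tx t') ∧
  (∀ t ∈ S, (∑ t' ∈ S.filter (fun t' => t' ≤ t), tx t')
      - ((L.filter (fun e => decide (e.1 + F < t))).map Prod.snd).sum ≤ C)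

/-- The profit of an execution: `p · (total settled value) − τ · (number of flushes)`. -/
def PProfit (p τ : ℝ) (tx : ℕ → ℝ) (S : Finset ℕ) (L : List (ℕ × ℝ)) : ℝ :=
  p * ∑ t ∈ S, tx t - τ * L.length

/-! ### Deterministic online 1-wallet algorithms -/

/-- A deterministic online 1-wallet algorithm: at each time `t` it decides, as a function
of the prefix `(tx 1, …, tx t)`, whether to settle `tx t` and whether to flush the wallet
at time `t`. -/
structure OnlineAlg where
  settles : List ℝ → Bool
  flushes : List ℝ → Bool

/-- The prefix `[tx 1, …, tx t]` of a transaction sequence. -/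
def prefixList (tx : ℕ → ℝ) (t : ℕ) : List ℝ := (List.range t).map (fun j => tx (j + 1))

/-- The settlement assignment induced by a deterministic online 1-wallet algorithm. -/
def inducedS (A : OnlineAlg) (n : ℕ) (tx : ℕ → ℝ) : ℕ → Option ℕ := fun t =>
  if t ∈ Finset.Icc 1 n ∧ A.settles (prefixList tx t) then some 0 else none

/-- The flush-time sets induced by a deterministic online 1-wallet algorithm. -/
def inducedPhi (A : OnlineAlg) (n : ℕ) (tx : ℕ → ℝ) : ℕ → Finset ℕ := fun _ =>
  (Finset.Icc 1 n).filter (fun t => A.flushes (prefixList tx t))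

/-- `V_A(tx)`: the total value settled by the online algorithm `A` on `tx`. -/
def VOnline (A : OnlineAlg) (n : ℕ) (tx : ℕ → ℝ) : ℝ := DValue n tx (inducedS A n tx)

end

/-- In at most `F + 1` consecutive slots, a single wallet settles at most its size. -/
theorem DFeasible.sum_wallet_window_le {F k n : ℕ} {C : ℝ} {tx : ℕ → ℝ} {s : ℕ → Option ℕ}
    {Φ : ℕ → Finset ℕ} (h : DFeasible F C k n tx s Φ) (hC : 0 ≤ C)
    (htx : ∀ t ∈ Icc 1 n, 0 ≤ tx t) {b m : ℕ} (hb : 1 ≤ b) (hmb : m ≤ b + F) (hmn : m ≤ n)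
    (i : ℕ) : ∑ t ∈ (Icc b m).filter (fun t => s t = some i), tx t ≤ C / k := by
  rcases ((Icc b m).filter (fun t => s t = some i)).eq_empty_or_nonempty with hA | hA
  · rw [hA, sum_empty]
    positivity
  obtain ⟨t, ht, hmax⟩ := exists_max_image _ id hA
  simp only [mem_filter, mem_Icc, id] at ht hmax
  obtain ⟨hon, hle⟩ := h.2.2 t i ht.2
  refine le_trans (sum_le_sum_of_subset_of_nonneg ?_ ?_) hle
  · intro t' ht'
    simp only [mem_filter, mem_Icc] at ht' ⊢
    refine ⟨⟨by omega, hmax t' ht'⟩, ht'.2, ?_⟩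
    rintro u hu ⟨h1, h2⟩
    exact hon ⟨u, hu, h2, by omega⟩
  · intro t' ht' _
    simp only [mem_filter, mem_Icc] at ht'
    exact htx t' (mem_Icc.2 (by omega))

/-- In at most `F + 1` consecutive slots, a feasible execution settles at most `C`. -/
theorem DFeasible.sum_window_le {F k n : ℕ} {C : ℝ} {tx : ℕ → ℝ} {s : ℕ → Option ℕ}
    {Φ : ℕ → Finset ℕ} (h : DFeasible F C k n tx s Φ) (hC : 0 ≤ C) (hk : 1 ≤ k)
    (htx : ∀ t ∈ Icc 1 n, 0 ≤ tx t) {b m : ℕ} (hb : 1 ≤ b) (hmb : m ≤ b + F) (hmn : m ≤ n) :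
    ∑ t ∈ (Icc b m).filter (fun t => (s t).isSome), tx t ≤ C := by
  have hsplit : ∀ t, (if (s t).isSome then tx t else 0) =
      ∑ i ∈ range k, if s t = some i then tx t else 0 := by
    intro t
    rcases hst : s t with _ | j
    · simp
    · have hj := (h.2.1 t j hst).1
      simp [hj]
  calc ∑ t ∈ (Icc b m).filter (fun t => (s t).isSome), tx t
      = ∑ i ∈ range k, ∑ t ∈ (Icc b m).filter (fun t => s t = some i), tx t := by
        simp only [sum_filter, hsplit]
        exact sum_comm
    _ ≤ ∑ _i ∈ range k, C / k :=
        sum_le_sum fun i _ => h.sum_wallet_window_le hC htx hb hmb hmn i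
    _ = C := by
        have : (k : ℝ) ≠ 0 := by positivity
        simp [mul_div_cancel₀ _ this]

theorem DValue_succ (m : ℕ) (tx : ℕ → ℝ) (s : ℕ → Option ℕ) :
    DValue (m + 1) tx s = DValue m tx s + if (s (m + 1)).isSome then tx (m + 1) else 0 := by
  simp only [DValue, sum_filter]
  rw [sum_Icc_succ_top (by omega)]

theorem DValue_add_sum_window {a m : ℕ} (ham : a ≤ m) (tx : ℕ → ℝ) (s : ℕ → Option ℕ) :
    DValue m tx s =
      DValue a tx s + ∑ t ∈ (Icc (a + 1) m).filter (fun t => (s t).isSome), tx t := by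
  induction m, ham using Nat.le_induction with
  | base => simp
  | succ m ham ih =>
    rw [DValue_succ, ih]
    simp only [sum_filter]
    rw [sum_Icc_succ_top (by omega)]
    ring

theorem faRun_succ (C : ℝ) (k F m : ℕ) (tx : ℕ → ℝ) :
    faRun C k F (m + 1) tx = faStep C k F (faRun C k F m tx) (m + 1) (tx (m + 1)) := by
  simp [faRun, List.range_succ]

/-- The value `FlushAll` has settled in its wallets since its last flush. -/
noncomputable def FAState.load (C : ℝ) (k : ℕ) (st : FAState) : ℝ := ∑ i ∈ range k, (C / k - st.cap i)

/-- The invariant relating `FlushAll` after slot `m` to another execution with assignment `s`.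
Either the wallets are online in slot `m + 1`, or they are offline because of a flush in some
slot `b`. -/
def FAInvariant (C R : ℝ) (k F m : ℕ) (tx : ℕ → ℝ) (s : ℕ → Option ℕ) (st : FAState) : Prop :=
  0 ≤ st.load C k ∧
    ((st.offlineUntil ≤ m ∧
        DValue m tx s ≤ R * (st.settled - st.load C k) + st.load C k) ∨
      ∃ b, b + 1 ≤ m ∧ m < b + 1 + F ∧ st.offlineUntil = b + 1 + F ∧ st.load C k = 0 ∧
        DValue b tx s + C ≤ R * st.settled)

theorem FAInvariant.step {C T R : ℝ} {k F m n : ℕ} {tx : ℕ → ℝ} {s : ℕ → Option ℕ}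
    {Φ : ℕ → Finset ℕ} {st : FAState} (hC : 0 ≤ C) (hk : 1 ≤ k) (hF : 1 ≤ F) (hR : 1 ≤ R)
    (hRT : C ≤ (R - 1) * (C - k * T)) (htx : ∀ t ∈ Icc 1 n, 0 ≤ tx t ∧ tx t ≤ T)
    (hs : DFeasible F C k n tx s Φ) (hmn : m + 1 ≤ n) (h : FAInvariant C R k F m tx s st) :
    FAInvariant C R k F (m + 1) tx s (faStep C k F st (m + 1) (tx (m + 1))) := by
  obtain ⟨hv0, hvT⟩ := htx (m + 1) (mem_Icc.2 (by omega))
  obtain ⟨hW, ⟨hoff, hO⟩ | ⟨b, hbm, hmb, hoff, hW0, hO⟩⟩ := h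
  · rw [faStep, if_neg (by omega)]
    split_ifs with hfit
    · have hload : FAState.load C k
          { st with
            cap := fun j => if j = Nat.find hfit then st.cap (Nat.find hfit) - tx (m + 1)
              else st.cap j
            settled := st.settled + tx (m + 1) } = st.load C k + tx (m + 1) := by
        have hterm : ∀ j, C / k - (if j = Nat.find hfit then
            st.cap (Nat.find hfit) - tx (m + 1) else st.cap j) =
            (C / k - st.cap j) + if j = Nat.find hfit then tx (m + 1) else 0 := by
          intro j
          split_ifs with hj
          · rw [hj]
            ring
          · ring
        simp only [FAState.load, hterm]
        rw [sum_add_distrib, sum_ite_eq', if_pos (mem_range.2 (Nat.find_spec hfit).1)]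
      refine ⟨hload ▸ by positivity, Or.inl ⟨by dsimp only; omega, ?_⟩⟩
      rw [hload, DValue_succ]
      dsimp only
      split_ifs <;> linarith
    · push Not at hfit
      have hfull : C - k * T ≤ st.load C k := by
        have hk0 : (k : ℝ) ≠ 0 := by positivity
        calc C - k * T = ∑ _i ∈ range k, (C / k - T) := by
              simp only [sum_const, card_range, nsmul_eq_mul]
              field_simp
          _ ≤ st.load C k := sum_le_sum fun i hi => by
              linarith [hfit i (mem_range.1 hi)]
      refine ⟨by simp [FAState.load], Or.inr ⟨m, le_rfl, by omega, rfl, ?_, ?_⟩⟩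
      · simp [FAState.load]
      · have := mul_le_mul_of_nonneg_left hfull (sub_nonneg.2 hR)
        dsimp only
        linarith
  · rw [faStep, if_pos (by omega)]
    refine ⟨hW, ?_⟩
    by_cases hlast : m + 1 < b + 1 + F
    · exact Or.inr ⟨b, by omega, hlast, hoff, hW0, hO⟩
    · refine Or.inl ⟨by omega, ?_⟩
      have := hs.sum_window_le hC hk (fun t ht => (htx t ht).1)
        (b := b + 1) (m := m + 1) (by omega) (by omega) hmn
      rw [DValue_add_sum_window (a := b) (by omega), hW0]
      linarith

theorem FAInvariant.faRun {C T R : ℝ} {k F m n : ℕ} {tx : ℕ → ℝ} {s : ℕ → Option ℕ}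
    {Φ : ℕ → Finset ℕ} (hC : 0 ≤ C) (hk : 1 ≤ k) (hF : 1 ≤ F) (hR : 1 ≤ R)
    (hRT : C ≤ (R - 1) * (C - k * T)) (htx : ∀ t ∈ Icc 1 n, 0 ≤ tx t ∧ tx t ≤ T)
    (hs : DFeasible F C k n tx s Φ) (hmn : m ≤ n) :
    FAInvariant C R k F m tx s (faRun C k F m tx) := by
  induction m with
  | zero => simp [FAInvariant, _root_.faRun, FAState.load, DValue]
  | succ m ih =>
    rw [faRun_succ]
    exact (ih (by omega)).step hC hk hF hR hRT htx hs hmn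

/-- `FlushAll` is `(2 − r)/(1 − r)`-competitive in the discrete
`k`-wallet model, where `r = kT/C < 1`: every feasible execution (in particular an
optimal one) settles at most `(2 − r)/(1 − r)` times the value settled by `FlushAll`,
up to an additive constant independent of `n` and the transaction sequence. -/
theorem flushAll_competitive (C T : ℝ) (k F : ℕ)
    (hC : 0 < C) (hT : 0 < T) (hk : 1 ≤ k) (hF : 1 ≤ F)
    (hr : (k : ℝ) * T / C < 1) :
    ∃ c₀ : ℝ, 0 ≤ c₀ ∧ ∀ (n : ℕ) (tx : ℕ → ℝ),
      (∀ t ∈ Finset.Icc 1 n, 0 ≤ tx t ∧ tx t ≤ T) →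
      ∀ (s : ℕ → Option ℕ) (Φ : ℕ → Finset ℕ), DFeasible F C k n tx s Φ →
        DValue n tx s ≤
          ((2 - (k : ℝ) * T / C) / (1 - (k : ℝ) * T / C)) * VFA C k F n tx + c₀ := by
  have h1r : 0 < 1 - (k : ℝ) * T / C := sub_pos.2 hr
  have hR1 : (2 - (k : ℝ) * T / C) / (1 - (k : ℝ) * T / C) - 1 = 1 / (1 - (k : ℝ) * T / C) := by
    rw [div_sub_one h1r.ne']
    congr 1
    ring
  set R := (2 - (k : ℝ) * T / C) / (1 - (k : ℝ) * T / C)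
  have hR : 1 ≤ R := by
    have : 0 < 1 / (1 - (k : ℝ) * T / C) := by positivity
    linarith
  have hRT : C ≤ (R - 1) * (C - k * T) := by
    have hfac : C - k * T = (1 - (k : ℝ) * T / C) * C := by
      field_simp
    rw [hR1, hfac, ← mul_assoc, one_div_mul_cancel h1r.ne', one_mul]
  refine ⟨0, le_rfl, fun n tx htx s Φ hs => ?_⟩
  rw [add_zero, VFA]
  obtain ⟨hW, ⟨-, hO⟩ | ⟨b, hbn, hnb, -, -, hO⟩⟩ :=
    FAInvariant.faRun hC.le hk hF hR hRT htx hs le_rfl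
  · have := mul_nonneg (sub_nonneg.2 hR) hW
    linarith
  · have := hs.sum_window_le hC.le hk (fun t ht => (htx t ht).1)
      (b := b + 1) (m := n) (by omega) (by omega) le_rfl
    rw [DValue_add_sum_window (a := b) (by omega)]
    linarith
end

section
/- (No deterministic 1-wallet algorithm is competitive when the maximum transaction size equals the collateral.) Let C > 0 be a real and F ≥ 1 an integer flush period, and take the maximum transaction size T = C. For every deterministic online 1-wallet algorithm A with collateral C and for all constants α ≥ 1 and c ≥ 0, there exist an n and a transaction sequence tx of length n with values in [0, C] such that OPT_D(C,1;tx) > α · V_A(tx) + c. -/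
open Finset

/-- Settling exactly the slots of a set `S` whose elements are more than `F` apart, and flushing
after each of them, is feasible for one wallet. -/
theorem dFeasible_of_separated {F n : ℕ} {C : ℝ} {tx : ℕ → ℝ} {S : Finset ℕ}
    (hS : S ⊆ Finset.Icc 1 n) (hle : ∀ t ∈ S, tx t ≤ C)
    (hsep : ∀ a ∈ S, ∀ b ∈ S, a < b → a + F < b) :
    DFeasible F C 1 n tx (fun t => if t ∈ S then some 0 else none) (fun _ => S) := by
  refine ⟨fun _ => hS, ?_, ?_⟩
  · intro t i h
    by_cases ht : t ∈ S
    · simp only [ht, if_true, Option.some.injEq] at h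
      exact ⟨by omega, hS ht⟩
    · simp [ht] at h
  · intro t i h
    by_cases ht : t ∈ S
    · simp only [ht, if_true, Option.some.injEq] at h
      subst h
      refine ⟨?_, ?_⟩
      · rintro ⟨a, ha, hat, hta⟩
        have := hsep a ha t ht hat
        omega
      · have hfilter : (Finset.Icc 1 t).filter
            (fun t' => (if t' ∈ S then some 0 else none) = some 0 ∧
              ∀ u ∈ S, ¬ (t' ≤ u ∧ u < t)) = {t} := by
          ext a
          simp only [Finset.mem_filter, Finset.mem_Icc, Finset.mem_singleton]
          constructor
          · rintro ⟨⟨_, hat⟩, ha, hu⟩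
            by_cases haS : a ∈ S
            · have := hu a haS
              omega
            · simp [haS] at ha
          · rintro rfl
            refine ⟨⟨(Finset.mem_Icc.1 (hS ht)).1, le_rfl⟩, by simp [ht], ?_⟩
            intro u _
            omega
        rw [hfilter]
        simpa using hle t ht
    · simp [ht] at h

/-- The value of the execution settling exactly the slots of `S`. -/
theorem dValue_indicator {n : ℕ} {tx : ℕ → ℝ} {S : Finset ℕ} (hS : S ⊆ Finset.Icc 1 n) :
    DValue n tx (fun t => if t ∈ S then some 0 else none) = ∑ t ∈ S, tx t := by
  unfold DValue
  congr 1
  ext a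
  by_cases ha : a ∈ S
  · simpa [ha] using Finset.mem_Icc.1 (hS ha)
  · simp [ha]

theorem length_prefixList (tx : ℕ → ℝ) (t : ℕ) : (prefixList tx t).length = t := by
  simp [prefixList]

theorem prefixList_succ (tx : ℕ → ℝ) (t : ℕ) :
    prefixList tx (t + 1) = prefixList tx t ++ [tx (t + 1)] := by
  simp [prefixList, List.range_succ]

theorem take_prefixList (tx : ℕ → ℝ) {s t : ℕ} (h : s ≤ t) :
    (prefixList tx t).take s = prefixList tx s := by
  simp [prefixList, ← List.map_take, List.take_range, Nat.min_eq_left h]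

/-- The first `t` transactions produced by an adversary choosing each transaction as a function
`g` of its predecessors. -/
def adaptivePrefix (g : List ℝ → ℝ) : ℕ → List ℝ
  | 0 => []
  | t + 1 => adaptivePrefix g t ++ [g (adaptivePrefix g t)]

theorem exists_adaptive (g : List ℝ → ℝ) :
    ∃ tx : ℕ → ℝ, ∀ t, tx (t + 1) = g (prefixList tx t) := by
  let tx : ℕ → ℝ := fun t => g (adaptivePrefix g (t - 1))
  have hprefix : ∀ t, prefixList tx t = adaptivePrefix g t := by
    intro t
    induction t with
    | zero => rfl
    | succ t ih => rw [prefixList_succ, ih]; rfl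
  exact ⟨tx, fun t => by rw [hprefix]; rfl⟩

/-- After the history `l`, the wallet of `A` is offline or contains a settled transaction that has
not been flushed. -/
def Blocked (A : OnlineAlg) (F : ℕ) (l : List ℝ) : Prop :=
  (∃ a, 1 ≤ a ∧ a ≤ l.length ∧ A.flushes (l.take a) ∧ l.length + 1 ≤ a + F) ∨
  (∃ a, 1 ≤ a ∧ a ≤ l.length ∧ A.settles (l.take a) ∧
    ∀ u, a ≤ u → u ≤ l.length → ¬ A.flushes (l.take u))

theorem blocked_prefixList {A : OnlineAlg} {F t : ℕ} {tx : ℕ → ℝ} :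
    Blocked A F (prefixList tx t) ↔
      (∃ a, 1 ≤ a ∧ a ≤ t ∧ A.flushes (prefixList tx a) ∧ t + 1 ≤ a + F) ∨
      (∃ a, 1 ≤ a ∧ a ≤ t ∧ A.settles (prefixList tx a) ∧
        ∀ u, a ≤ u → u ≤ t → ¬ A.flushes (prefixList tx u)) := by
  unfold Blocked
  rw [length_prefixList]
  refine or_congr (exists_congr fun a => and_congr_right fun _ => and_congr_right fun ha => ?_)
    (exists_congr fun a => and_congr_right fun _ => and_congr_right fun ha => ?_)
  · rw [take_prefixList tx ha]
  · rw [take_prefixList tx ha]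
    refine and_congr_right fun _ => forall_congr' fun u => imp_congr_right fun _ =>
      forall_congr' fun hu => ?_
    rw [take_prefixList tx hu]

/-- A blocked wallet cannot settle a transaction of size `C`, all transactions being positive. -/
theorem not_settles_of_blocked {A : OnlineAlg} {F t : ℕ} {C : ℝ} {tx : ℕ → ℝ}
    (hpos : ∀ a, 1 ≤ a → 0 < tx a) (htx : tx (t + 1) = C)
    (hA : DFeasible F C 1 (t + 1) tx (inducedS A (t + 1) tx) (inducedPhi A (t + 1) tx))
    (hB : Blocked A F (prefixList tx t)) : ¬ A.settles (prefixList tx (t + 1)) := by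
  intro hs
  obtain ⟨hon, hsum⟩ := hA.2.2 (t + 1) 0 (by simp [inducedS, hs])
  rcases blocked_prefixList.1 hB with ⟨a, ha1, hat, hfl, hta⟩ | ⟨a, ha1, hat, hsa, hnf⟩
  · refine hon ⟨a, ?_, by omega, hta⟩
    simp only [inducedPhi, Finset.mem_filter, Finset.mem_Icc]
    exact ⟨⟨ha1, by omega⟩, hfl⟩
  · refine absurd ((Finset.sum_le_sum_of_subset_of_nonneg (s := {a, t + 1}) ?_ fun b hb _ =>
      (hpos b (Finset.mem_Icc.1 (Finset.mem_filter.1 hb).1).1).le).trans hsum) ?_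
    · intro b hb
      simp only [Finset.mem_insert, Finset.mem_singleton] at hb
      rcases hb with rfl | rfl
      · have hmem : b ∈ Finset.Icc 1 (t + 1) := Finset.mem_Icc.2 ⟨ha1, by omega⟩
        refine Finset.mem_filter.2 ⟨hmem, if_pos ⟨hmem, hsa⟩, ?_⟩
        rintro u hu ⟨hbu, hut⟩
        exact hnf u hbu (by omega) (Finset.mem_filter.1 hu).2
      · have hmem : t + 1 ∈ Finset.Icc 1 (t + 1) := Finset.mem_Icc.2 ⟨by omega, le_rfl⟩
        refine Finset.mem_filter.2 ⟨hmem, if_pos ⟨hmem, hs⟩, ?_⟩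
        intro u _
        omega
    · rw [Finset.sum_pair (by omega), htx, Nat.cast_one, div_one, not_le]
      linarith [hpos a ha1]

open Classical in
/-- Against the adversary sending `C` whenever `A` is blocked and `ε` otherwise, the algorithm
settles only transactions of size `ε`, these are more than `F` slots apart, and each is followed by
a transaction of size `C`. -/
theorem exists_adversary {A : OnlineAlg} {F : ℕ} {C ε : ℝ} (hF : 1 ≤ F) (hε : 0 < ε) (hεC : ε ≤ C)
    (hA : ∀ (n : ℕ) (tx : ℕ → ℝ), (∀ t ∈ Finset.Icc 1 n, 0 ≤ tx t ∧ tx t ≤ C) →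
      DFeasible F C 1 n tx (inducedS A n tx) (inducedPhi A n tx)) :
    ∃ tx : ℕ → ℝ, (∀ t, 1 ≤ t → ε ≤ tx t ∧ tx t ≤ C) ∧
      (∀ t, 1 ≤ t → A.settles (prefixList tx t) → tx t = ε ∧ tx (t + 1) = C) ∧
      (∀ a b, 1 ≤ a → A.settles (prefixList tx a) → A.settles (prefixList tx b) → a < b →
        a + F < b) := by
  obtain ⟨tx, htx⟩ := exists_adaptive (fun l => if Blocked A F l then C else ε)
  have hbound : ∀ t, 1 ≤ t → ε ≤ tx t ∧ tx t ≤ C := by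
    intro t ht
    obtain ⟨t, rfl⟩ := Nat.exists_eq_add_of_le' ht
    rw [htx]
    split_ifs <;> simp [hεC]
  have hfree : ∀ t, A.settles (prefixList tx (t + 1)) → ¬ Blocked A F (prefixList tx t) := by
    intro t hs hB
    refine not_settles_of_blocked (fun a ha => hε.trans_le (hbound a ha).1)
      (by rw [htx, if_pos hB]) (hA (t + 1) tx fun a ha => ?_) hB hs
    have := hbound a (Finset.mem_Icc.1 ha).1
    exact ⟨hε.le.trans this.1, this.2⟩
  refine ⟨tx, hbound, ?_, ?_⟩
  · intro t ht hs
    refine ⟨?_, ?_⟩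
    · obtain ⟨t, rfl⟩ := Nat.exists_eq_add_of_le' ht
      rw [htx, if_neg (hfree t hs)]
    · rw [htx, if_pos]
      rw [blocked_prefixList]
      by_cases hf : A.flushes (prefixList tx t)
      · exact Or.inl ⟨t, ht, le_rfl, hf, by omega⟩
      · refine Or.inr ⟨t, ht, le_rfl, hs, fun u h1 h2 => ?_⟩
        rwa [le_antisymm h2 h1]
  · intro a b ha hsa hsb hab
    obtain ⟨b, rfl⟩ := Nat.exists_eq_add_of_le' (show 1 ≤ b by omega)
    have hnb := hfree b hsb
    rw [blocked_prefixList] at hnb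
    push Not at hnb
    obtain ⟨u, hau, hub, hfl⟩ := hnb.2 a ha (by omega) hsa
    have := hnb.1 u (by omega) hub hfl
    omega

/-- An algorithm settling only transactions of size `ε` gains `ε` for each of them. -/
theorem vOnline_eq {A : OnlineAlg} {ε : ℝ} {tx : ℕ → ℝ} (n : ℕ)
    (hsmall : ∀ t, 1 ≤ t → A.settles (prefixList tx t) → tx t = ε) :
    VOnline A n tx =
      ((Finset.Icc 1 n).filter (fun t => A.settles (prefixList tx t))).card * ε := by
  have hset : (Finset.Icc 1 n).filter (fun t => (inducedS A n tx t).isSome) =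
      (Finset.Icc 1 n).filter (fun t => A.settles (prefixList tx t)) := by
    refine Finset.filter_congr fun t ht => ?_
    simp only [inducedS, ht, true_and]
    split_ifs with h <;> simp [h]
  rw [VOnline, DValue, hset, Finset.sum_eq_card_nsmul (b := ε), nsmul_eq_mul]
  intro t ht
  rw [Finset.mem_filter, Finset.mem_Icc] at ht
  exact hsmall t ht.1.1 ht.2

/-- No deterministic online 1-wallet algorithm is competitive when the
maximum transaction size equals the collateral `C`: for every such algorithm `A` (whose
induced execution is always feasible) and all constants `α ≥ 1`, `c ≥ 0` there is a
transaction sequence with values in `[0, C]` and a feasible execution whose value exceeds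
`α · V_A(tx) + c`. -/
theorem no_competitive_deterministic_one_wallet (C : ℝ) (F : ℕ)
    (hC : 0 < C) (hF : 1 ≤ F) (A : OnlineAlg)
    (hA : ∀ (n : ℕ) (tx : ℕ → ℝ), (∀ t ∈ Finset.Icc 1 n, 0 ≤ tx t ∧ tx t ≤ C) →
      DFeasible F C 1 n tx (inducedS A n tx) (inducedPhi A n tx)) :
    ∀ α c : ℝ, 1 ≤ α → 0 ≤ c →
      ∃ (n : ℕ) (tx : ℕ → ℝ),
        (∀ t ∈ Finset.Icc 1 n, 0 ≤ tx t ∧ tx t ≤ C) ∧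
        ∃ (s : ℕ → Option ℕ) (Φ : ℕ → Finset ℕ), DFeasible F C 1 n tx s Φ ∧
          DValue n tx s > α * VOnline A n tx + c := by
  intro α c hα hc
  have hα0 : 0 < α := by linarith
  set ε : ℝ := C / (2 * α) with hεdef
  have hε : 0 < ε := by positivity
  have hαε : α * ε = C / 2 := by rw [hεdef]; field_simp
  have hεC : ε ≤ C := by nlinarith
  obtain ⟨tx, hbound, hsettled, hsep⟩ := exists_adversary hF hε hεC hA
  have hrange : ∀ n, ∀ t ∈ Finset.Icc 1 n, 0 ≤ tx t ∧ tx t ≤ C := fun n t ht =>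
    have h := hbound t (Finset.mem_Icc.1 ht).1
    ⟨hε.le.trans h.1, h.2⟩
  let M : ℕ → Finset ℕ := fun n =>
    (Finset.Icc 1 n).filter (fun t => A.settles (prefixList tx t))
  have hV : ∀ n, α * VOnline A n tx = (M n).card * (C / 2) := fun n => by
    rw [vOnline_eq n fun t ht hs => (hsettled t ht hs).1, ← hαε]
    ring
  by_cases hM : ∃ n, 1 + 2 * c / C < (M n).card
  · obtain ⟨n, hn⟩ := hM
    let S := (M n).image (· + 1)
    have hmem : ∀ t ∈ S, ∃ a, 1 ≤ a ∧ a ≤ n ∧ A.settles (prefixList tx a) ∧ a + 1 = t := by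
      intro t ht
      obtain ⟨a, ha, hat⟩ := Finset.mem_image.1 ht
      obtain ⟨ha1, hs⟩ := Finset.mem_filter.1 ha
      exact ⟨a, (Finset.mem_Icc.1 ha1).1, (Finset.mem_Icc.1 ha1).2, hs, hat⟩
    have hS : S ⊆ Finset.Icc 1 (n + 1) := by
      intro t ht
      obtain ⟨a, _, _, _, rfl⟩ := hmem t ht
      exact Finset.mem_Icc.2 ⟨by omega, by omega⟩
    refine ⟨n + 1, tx, hrange _, _, _, dFeasible_of_separated hS
      (fun t ht => (hrange _ t (hS ht)).2) ?_, ?_⟩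
    · intro x hx y hy hxy
      obtain ⟨a, ha, _, hsa, rfl⟩ := hmem x hx
      obtain ⟨b, _, _, hsb, rfl⟩ := hmem y hy
      have := hsep a b ha hsa hsb (by omega)
      omega
    · have hsum : ∑ t ∈ S, tx t = (M n).card * C := by
        rw [Finset.sum_eq_card_nsmul (b := C), nsmul_eq_mul,
          Finset.card_image_of_injective _ (add_left_injective 1)]
        intro t ht
        obtain ⟨a, ha, _, hs, rfl⟩ := hmem t ht
        exact (hsettled a ha hs).2
      have hcard : (M (n + 1)).card ≤ (M n).card + 1 := by
        refine (Finset.card_le_card (t := insert (n + 1) (M n)) ?_).trans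
          (Finset.card_insert_le _ _)
        intro t ht
        simp only [M, Finset.mem_insert, Finset.mem_filter, Finset.mem_Icc] at ht ⊢
        by_cases h : t = n + 1
        · exact Or.inl h
        · exact Or.inr ⟨⟨ht.1.1, by omega⟩, ht.2⟩
      have hcard' : ((M (n + 1)).card : ℝ) ≤ (M n).card + 1 := by exact_mod_cast hcard
      rw [dValue_indicator hS, hsum, hV, gt_iff_lt]
      have hc' : 2 * c / C * C = 2 * c := by field_simp
      nlinarith
  · push Not at hM
    obtain ⟨q, hq⟩ := exists_nat_gt (((1 + 2 * c / C) * (C / 2) + c) / ε)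
    rw [div_lt_iff₀ hε] at hq
    let S := (Finset.Icc 1 q).image (· * (F + 1))
    have hS : S ⊆ Finset.Icc 1 (q * (F + 1)) := by
      intro t ht
      obtain ⟨a, ha, rfl⟩ := Finset.mem_image.1 ht
      rw [Finset.mem_Icc] at ha ⊢
      exact ⟨Nat.mul_pos ha.1 F.succ_pos, Nat.mul_le_mul_right _ ha.2⟩
    refine ⟨q * (F + 1), tx, hrange _, _, _, dFeasible_of_separated hS
      (fun t ht => (hrange _ t (hS ht)).2) ?_, ?_⟩
    · intro x hx y hy hxy
      obtain ⟨a, _, rfl⟩ := Finset.mem_image.1 hx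
      obtain ⟨b, _, rfl⟩ := Finset.mem_image.1 hy
      have hab : a + 1 ≤ b := lt_of_mul_lt_mul_right hxy (Nat.zero_le _)
      have := Nat.mul_le_mul_right (F + 1) hab
      linarith
    · have hsum : q * ε ≤ ∑ t ∈ S, tx t := by
        have h := Finset.card_nsmul_le_sum S tx ε
          fun t ht => (hbound t (Finset.mem_Icc.1 (hS ht)).1).1
        rwa [Finset.card_image_of_injective _ (mul_left_injective₀ F.succ_ne_zero),
          Nat.card_Icc, nsmul_eq_mul, Nat.add_sub_cancel] at h
      rw [dValue_indicator hS, hV, gt_iff_lt]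
      have := mul_le_mul_of_nonneg_right (hM (q * (F + 1))) (by positivity : 0 ≤ C / 2)
      linarith
end

section
/- (FlushTwoWhenFull is 2(k+1)/k-competitive when the maximum transaction size equals the wallet size.) Let C > 0 be a real, k ≥ 2 an even integer, F ≥ 1 an integer flush period, and let the maximum transaction size be T = C/k (so r = kT/C = 1). Then there is a constant c₀ ≥ 0 depending only on C, k, F such that for every n and every transaction sequence tx of length n with values in [0, C/k], OPT_D(C,k;tx) ≤ (2(k+1)/k) · V_FTWF(tx) + c₀. -/
open Finset

/-- The value settled by the assignment `s` strictly before time `T`. -/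
def settledBefore (tx : ℕ → ℝ) (s : ℕ → Option ℕ) (T : ℕ) : ℝ :=
  ∑ t ∈ (Finset.range T).filter (fun t => (s t).isSome), tx t

theorem settledBefore_zero (tx : ℕ → ℝ) (s : ℕ → Option ℕ) : settledBefore tx s 0 = 0 := by
  simp [settledBefore]

theorem settledBefore_succ_le {tx : ℕ → ℝ} {s : ℕ → Option ℕ} {T : ℕ} {b : ℝ}
    (hb : 0 ≤ b) (h : (s T).isSome → tx T ≤ b) :
    settledBefore tx s (T + 1) ≤ settledBefore tx s T + b := by
  unfold settledBefore
  rw [Finset.range_add_one, Finset.filter_insert]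
  split_ifs with hs
  · rw [Finset.sum_insert (by simp)]
    linarith [h hs]
  · linarith

/-- In a feasible execution, one wallet settles at most `C / k` in any `F + 1` consecutive
slots: a flush inside the window keeps the wallet offline until its end. -/
theorem DFeasible.sum_window_wallet_le {F k n : ℕ} {C : ℝ} {tx : ℕ → ℝ}
    {s : ℕ → Option ℕ} {Φ : ℕ → Finset ℕ} (hf : DFeasible F C k n tx s Φ) (hC : 0 ≤ C / k)
    (htx : ∀ t ∈ Finset.Icc 1 n, 0 ≤ tx t) {g T : ℕ} (hT : T ≤ g + F) (i : ℕ) :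
    ∑ t ∈ (Finset.Icc g T).filter (fun t => s t = some i), tx t ≤ C / k := by
  obtain ⟨-, hs, hfeas⟩ := hf
  set A := (Finset.Icc g T).filter (fun t => s t = some i) with hA
  have mem_A : ∀ t, t ∈ A ↔ (g ≤ t ∧ t ≤ T) ∧ s t = some i := by simp [hA]
  rcases A.eq_empty_or_nonempty with hE | hne
  · simpa [hE] using hC
  obtain ⟨hm, hsm⟩ := (mem_A _).1 (A.max'_mem hne)
  obtain ⟨hon, hle⟩ := hfeas _ i hsm
  refine le_trans (Finset.sum_le_sum_of_subset_of_nonneg ?_ ?_) hle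
  · intro t ht
    obtain ⟨⟨hgt, -⟩, hst⟩ := (mem_A t).1 ht
    have h1 := Finset.mem_Icc.1 (hs t i hst).2
    refine Finset.mem_filter.2 ⟨Finset.mem_Icc.2 ⟨h1.1, A.le_max' t ht⟩, hst, ?_⟩
    rintro u hu ⟨htu, hum⟩
    exact hon ⟨u, hu, hum, by omega⟩
  · intro t ht _
    exact htx t (hs t i (Finset.mem_filter.1 ht).2.1).2

/-- In a feasible execution, at most `C` is settled in any `F + 1` consecutive slots. -/
theorem DFeasible.settledBefore_window_le {F k n : ℕ} {C : ℝ} {tx : ℕ → ℝ}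
    {s : ℕ → Option ℕ} {Φ : ℕ → Finset ℕ} (hf : DFeasible F C k n tx s Φ)
    (hk : k ≠ 0) (hC : 0 ≤ C) (htx : ∀ t ∈ Finset.Icc 1 n, 0 ≤ tx t)
    {g T : ℕ} (hgT : g ≤ T + 1) (hT : T ≤ g + F) :
    settledBefore tx s (T + 1) ≤ settledBefore tx s g + C := by
  have hsplit : (Finset.range (T + 1)).filter (fun t => (s t).isSome) =
      (Finset.range g).filter (fun t => (s t).isSome) ∪
        (Finset.range k).biUnion (fun i => (Finset.Icc g T).filter (fun t => s t = some i)) := by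
    ext t
    simp only [Finset.mem_filter, Finset.mem_range, Finset.mem_union, Finset.mem_biUnion,
      Finset.mem_Icc, Option.isSome_iff_exists]
    constructor
    · rintro ⟨ht, i, hi⟩
      by_cases htg : t < g
      · exact Or.inl ⟨htg, i, hi⟩
      · exact Or.inr ⟨i, (hf.2.1 t i hi).1, ⟨by omega, by omega⟩, hi⟩
    · rintro (⟨ht, h⟩ | ⟨i, -, ht, hi⟩)
      · exact ⟨by omega, h⟩
      · exact ⟨by omega, i, hi⟩
  unfold settledBefore
  rw [hsplit, Finset.sum_union, Finset.sum_biUnion]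
  · have h := Finset.sum_le_card_nsmul (Finset.range k)
      (fun i => ∑ t ∈ (Finset.Icc g T).filter (fun t => s t = some i), tx t) (C / k)
      (fun i _ => hf.sum_window_wallet_le (by positivity) htx hT i)
    rw [Finset.card_range, nsmul_eq_mul, mul_div_cancel₀ _ (by exact_mod_cast hk)] at h
    linarith
  · intro i _ j _ hij
    refine Finset.disjoint_left.2 fun t hi hj => hij ?_
    have h1 := (Finset.mem_filter.1 hi).2
    have h2 := (Finset.mem_filter.1 hj).2
    exact Option.some.inj (h1.symm.trans h2)
  · refine Finset.disjoint_left.2 fun t h1 h2 => ?_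
    simp only [Finset.mem_filter, Finset.mem_range, Finset.mem_biUnion, Finset.mem_Icc] at h1 h2
    obtain ⟨i, -, h3, -⟩ := h2
    omega

theorem DValue_eq_settledBefore {F k n : ℕ} {C : ℝ} {tx : ℕ → ℝ}
    {s : ℕ → Option ℕ} {Φ : ℕ → Finset ℕ} (hf : DFeasible F C k n tx s Φ) :
    DValue n tx s = settledBefore tx s (n + 1) := by
  unfold DValue settledBefore
  congr 1
  ext t
  simp only [Finset.mem_filter, Finset.mem_range, Finset.mem_Icc]
  constructor
  · rintro ⟨h, hs⟩
    exact ⟨by omega, hs⟩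
  · rintro ⟨-, hs⟩
    obtain ⟨i, hi⟩ := Option.isSome_iff_exists.1 hs
    exact ⟨Finset.mem_Icc.1 (hf.2.1 t i hi).2, hs⟩

/-- Invariant of `FlushTwoWhenFull` after slot `t`, with `h` pairs of wallets of size `w`, for a
competing assignment `s`. Here `f m` is the time of the `m`-th flush (`f 0 = 0`), `V m` is the
value settled up to then, and the last field bounds the value of `s` by its value before either
the latest flush or the latest flush of the active pair. -/
structure FTWFInvariant (w ρ : ℝ) (h F : ℕ) (tx : ℕ → ℝ) (s : ℕ → Option ℕ) (t : ℕ)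
    (st : FTWFState) (f : ℕ → ℕ) (V : ℕ → ℝ) : Prop where
  flush_le : ∀ m ≤ st.active, f m ≤ t
  growth : ∀ i j, i ≤ j → j ≤ st.active → V i + ((j : ℝ) - i) * w ≤ V j
  competitive : ∀ m ≤ st.active, settledBefore tx s (f m) ≤ ρ * V m
  offline : ∀ m, st.active ≤ m → m < st.active + h →
    st.offlineUntil (m % h) = if h ≤ m then f (m + 1 - h) + F else 0
  settled_eq : st.settled = V st.active + ((w - st.cap1) + (w - st.cap2))
  cap1_le : st.cap1 ≤ w
  cap2_eq_or : st.cap2 = w ∨ st.cap1 + st.cap2 ≤ w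
  cap2_le : st.cap2 ≤ w
  current : settledBefore tx s (t + 1) ≤
      settledBefore tx s (f st.active) + w + ((w - st.cap1) + (w - st.cap2)) ∨
    (h ≤ st.active ∧ settledBefore tx s (t + 1) ≤
      settledBefore tx s (f (st.active + 1 - h)) + 2 * h * w + ((w - st.cap1) + (w - st.cap2)))

theorem FTWFInvariant.step {w ρ : ℝ} {h F : ℕ} {tx : ℕ → ℝ} {s : ℕ → Option ℕ} {t : ℕ}
    {st : FTWFState} {f : ℕ → ℕ} {V : ℕ → ℝ} (inv : FTWFInvariant w ρ h F tx s t st f V)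
    {C : ℝ} {k : ℕ} (hw : 0 ≤ w) (hh : 1 ≤ h) (hCk : C / k = w) (hkh : k / 2 = h)
    (hρ : 2 ≤ ρ) (hρh : ρ * h = 2 * h + 1)
    (htx : 0 ≤ tx (t + 1) ∧ tx (t + 1) ≤ w)
    (hwin : ∀ g, g ≤ t + 2 → t + 1 ≤ g + F →
      settledBefore tx s (t + 2) ≤ settledBefore tx s g + 2 * h * w) :
    ∃ f' V', FTWFInvariant w ρ h F tx s (t + 1) (ftwfStep C k F st (t + 1) (tx (t + 1))) f' V' := by
  obtain ⟨hfl, hgr, hcomp, hoff, hset, hc1, hc2, hc2', hcur⟩ := inv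
  have hstep := settledBefore_succ_le (s := s) (T := t + 1) htx.1 (fun _ => le_rfl)
  unfold ftwfStep
  rw [hkh, hCk]
  split_ifs with h1 h2 h3
  · refine ⟨f, V, fun m hm => (hfl m hm).trans (Nat.le_succ _), hgr, hcomp, hoff, hset, hc1, hc2,
      hc2', ?_⟩
    rw [hoff _ le_rfl (by omega)] at h1
    split_ifs at h1 with hM
    · right
      refine ⟨hM, ?_⟩
      have := hwin (f (st.active + 1 - h))
        (by have := hfl (st.active + 1 - h) (by omega); omega) h1
      show settledBefore tx s (t + 2) ≤ _
      linarith
    · omega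
  · refine ⟨f, V, fun m hm => (hfl m hm).trans (Nat.le_succ _), hgr, hcomp, hoff, ?_, ?_, ?_,
      hc2', ?_⟩
    · simp only [hset]; ring
    · simp only; linarith
    · rcases hc2 with hc | hc
      · exact Or.inl hc
      · right; simp only; linarith
    · rcases hcur with hc | ⟨hM, hc⟩
      · left; simp only; linarith
      · right; refine ⟨hM, ?_⟩; simp only; linarith
  · refine ⟨f, V, fun m hm => (hfl m hm).trans (Nat.le_succ _), hgr, hcomp, hoff, ?_, hc1, ?_,
      ?_, ?_⟩
    · simp only [hset]; ring
    · right; simp only; linarith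
    · simp only; linarith
    · rcases hcur with hc | ⟨hM, hc⟩
      · left; simp only; linarith
      · right; refine ⟨hM, ?_⟩; simp only; linarith
  · have hfull : w ≤ (w - st.cap1) + (w - st.cap2) := by
      rcases hc2 with hc | hc
      · exact absurd (hc ▸ htx.2) h3
      · linarith
    have hstep' := settledBefore_succ_le (s := s) (T := t + 1) hw (fun _ => htx.2)
    have hnew : settledBefore tx s (t + 1) ≤ ρ * st.settled := by
      rw [hset]
      rcases hcur with hc | ⟨hM, hc⟩
      · nlinarith [hcomp st.active le_rfl]
      · have hg := hgr (st.active + 1 - h) st.active (by omega) le_rfl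
        have ho := hcomp (st.active + 1 - h) (by omega)
        rw [Nat.cast_sub (by omega)] at hg
        push_cast at hg
        have hg' : V (st.active + 1 - h) + h * w - w ≤ V st.active := by linarith
        have := mul_le_mul_of_nonneg_left hg' (by linarith : (0 : ℝ) ≤ ρ)
        have e : ρ * (V (st.active + 1 - h) + h * w - w) =
          ρ * V (st.active + 1 - h) + (2 * h + 1) * w - ρ * w := by rw [← hρh]; ring
        nlinarith
    refine ⟨fun m => if m ≤ st.active then f m else t + 1,
      fun m => if m ≤ st.active then V m else st.settled, ?_, ?_, ?_, ?_, ?_, ?_, ?_, ?_, ?_⟩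
    · intro m _
      split_ifs with hm'
      · exact (hfl m hm').trans (Nat.le_succ _)
      · exact le_rfl
    · intro i j hij hj
      simp only at hj
      rcases Nat.lt_or_ge st.active j with hj' | hj'
      · obtain rfl : j = st.active + 1 := by omega
        rcases Nat.lt_or_ge st.active i with hi' | hi'
        · obtain rfl : i = st.active + 1 := by omega
          simp
        · have := hgr i st.active hi' le_rfl
          simp only [if_pos hi', if_neg (Nat.not_le.2 hj'), hset]
          push_cast
          linarith
      · simp only [if_pos hj', if_pos (hij.trans hj')]
        exact hgr i j hij hj'
    · intro m _
      split_ifs with hm'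
      · exact hcomp m hm'
      · exact hnew
    · intro m hm hm2
      simp only at hm hm2 ⊢
      rcases Nat.lt_or_ge m (st.active + h) with hlt | hge
      · have hne : m % h ≠ st.active % h := by
          intro he
          have hd := (Nat.modEq_iff_dvd' (by omega)).1 (he.symm : st.active ≡ m [MOD h])
          have := Nat.le_of_dvd (by omega) hd
          omega
        rw [if_neg hne, hoff m (by omega) hlt, if_pos (by omega : m + 1 - h ≤ st.active)]
      · obtain rfl : m = st.active + h := by omega
        rw [Nat.add_mod_right, if_pos rfl, if_pos (by omega), if_neg (by omega)]
    · simp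
    · exact le_rfl
    · exact Or.inl rfl
    · exact le_rfl
    · left
      simp only [if_neg (by omega : ¬ st.active + 1 ≤ st.active)]
      linarith

theorem ftwfRun_succ (C : ℝ) (k F n : ℕ) (tx : ℕ → ℝ) :
    ftwfRun C k F (n + 1) tx = ftwfStep C k F (ftwfRun C k F n tx) (n + 1) (tx (n + 1)) := by
  simp [ftwfRun, List.range_succ]

/-- `FlushTwoWhenFull` is `2(k+1)/k`-competitive when the maximum
transaction size equals the wallet size `C / k` (i.e. `r = 1`), for any even `k ≥ 2`. -/
theorem flushTwoWhenFull_competitive (C : ℝ) (k F : ℕ)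
    (hC : 0 < C) (hk : 2 ≤ k) (hke : Even k) (hF : 1 ≤ F) :
    ∃ c₀ : ℝ, 0 ≤ c₀ ∧ ∀ (n : ℕ) (tx : ℕ → ℝ),
      (∀ t ∈ Finset.Icc 1 n, 0 ≤ tx t ∧ tx t ≤ C / k) →
      ∀ (s : ℕ → Option ℕ) (Φ : ℕ → Finset ℕ), DFeasible F C k n tx s Φ →
        DValue n tx s ≤ (2 * ((k : ℝ) + 1) / (k : ℝ)) * VFTWF C k F n tx + c₀ := by
  refine ⟨C, hC.le, fun n tx htx s Φ hf => ?_⟩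
  obtain ⟨h, hkh⟩ := hke
  have hk2 : k / 2 = h := by omega
  have hk0 : (0 : ℝ) < k := by exact_mod_cast (by omega : 0 < k)
  have hkR : (k : ℝ) = 2 * h := by rw [hkh]; push_cast; ring
  obtain ⟨w, hw⟩ : ∃ w, C / k = w := ⟨_, rfl⟩
  obtain ⟨ρ, hρ⟩ : ∃ ρ, 2 * ((k : ℝ) + 1) / k = ρ := ⟨_, rfl⟩
  have hw0 : 0 ≤ w := hw ▸ by positivity
  have hCw : C = 2 * h * w := by rw [← hkR, ← hw]; field_simp
  have hρk : ρ * k = 2 * (k + 1) := by rw [← hρ]; field_simp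
  have hρh : ρ * h = 2 * h + 1 := by rw [hkR] at hρk; linarith
  have hρ2 : 2 ≤ ρ := by rw [← hρ, le_div_iff₀ hk0]; linarith
  have hh : (1 : ℝ) ≤ h := by exact_mod_cast (by omega : 1 ≤ h)
  have hs0 : ¬ (s 0).isSome := by
    intro h0
    obtain ⟨i, hi⟩ := Option.isSome_iff_exists.1 h0
    simpa using (hf.2.1 0 i hi).2
  have key : ∀ t ≤ n, ∃ f V, FTWFInvariant w ρ h F tx s t (ftwfRun C k F t tx) f V := by
    intro t
    induction t with
    | zero =>
      intro _
      refine ⟨fun _ => 0, fun m => m * w, ?_⟩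
      have hrun : ftwfRun C k F 0 tx = ⟨w, w, 0, fun _ => 0, 0⟩ := by simp [ftwfRun, hw]
      rw [hrun]
      refine ⟨by simp, fun i j _ _ => le_of_eq (by ring), fun m _ => ?_, fun m _ hm => ?_, by simp,
        le_rfl, Or.inl rfl, le_rfl, Or.inl ?_⟩
      · rw [settledBefore_zero]; positivity
      · simp only at hm
        rw [if_neg (by omega)]
      · have := settledBefore_succ_le (tx := tx) hw0 (fun h0 => absurd h0 hs0)
        simp only
        linarith
    | succ t ih =>
      intro ht
      obtain ⟨f, V, inv⟩ := ih (by omega)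
      rw [ftwfRun_succ]
      refine inv.step hw0 (by omega) hw hk2 hρ2 hρh
        (hw ▸ htx (t + 1) (Finset.mem_Icc.2 ⟨by omega, ht⟩)) fun g hg hgF => ?_
      rw [← hCw]
      exact hf.settledBefore_window_le (by omega) hC.le (fun u hu => (htx u hu).1) hg hgF
  obtain ⟨f, V, inv⟩ := key n le_rfl
  rw [DValue_eq_settledBefore hf, hρ, VFTWF, inv.settled_eq]
  have ha : 0 ≤ (w - (ftwfRun C k F n tx).cap1) + (w - (ftwfRun C k F n tx).cap2) := by
    linarith [inv.cap1_le, inv.cap2_le]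
  have hwh : w ≤ h * w := le_mul_of_one_le_left hw0 hh
  have hρa := mul_le_mul_of_nonneg_right hρ2 ha
  rcases inv.current with hc | ⟨hM, hc⟩
  · have := inv.competitive _ le_rfl
    linarith
  · have hg := inv.growth ((ftwfRun C k F n tx).active + 1 - h) _ (by omega) le_rfl
    have ho := inv.competitive ((ftwfRun C k F n tx).active + 1 - h) (by omega)
    have hcast : (((ftwfRun C k F n tx).active + 1 - h : ℕ) : ℝ) ≤ (ftwfRun C k F n tx).active := by
      exact_mod_cast (by omega)
    have hV : V ((ftwfRun C k F n tx).active + 1 - h) ≤ V (ftwfRun C k F n tx).active := by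
      linarith [mul_nonneg (sub_nonneg.2 hcast) hw0]
    have := mul_le_mul_of_nonneg_left hV (by linarith : (0 : ℝ) ≤ ρ)
    linarith
end

section
/- (FlushWhenFull is competitive even against the optimal policy of the general collateral model.) Let C, T > 0 be reals, k ≥ 2 an integer, F ≥ 1 an integer flush period, and set r = kT/C; assume r < 1. Then for every n and every transaction sequence tx of length n with maximum transaction size T, OPT_G(C;tx) ≤ ((k+1)/(k(1−r))) · V_FWF(tx), where FlushWhenFull is run with k wallets each of size C/k. -/
open Finset

/-- The value of the members of `S` strictly before time `t`. -/
def valueBefore (tx : ℕ → ℝ) (S : Finset ℕ) (t : ℕ) : ℝ := ∑ u ∈ S with u < t, tx u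

theorem valueBefore_succ_le {tx : ℕ → ℝ} {t : ℕ} (ht : 0 ≤ tx t) (S : Finset ℕ) :
    valueBefore tx S (t + 1) ≤ valueBefore tx S t + tx t := by
  unfold valueBefore
  by_cases h : t ∈ S
  · have : S.filter (fun u => u < t + 1) = insert t (S.filter (fun u => u < t)) := by
      ext u; simp only [mem_filter, mem_insert]; grind
    rw [this, sum_insert (by simp), add_comm]
  · have : S.filter (fun u => u < t + 1) = S.filter (fun u => u < t) := by
      ext u; simp only [mem_filter]; grind
    rw [this]; linarith

/-- A feasible set settles at most `C` in any time window `[u, t]` with `t ≤ u + F`. -/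
theorem GFeasible.valueBefore_window_le {F n : ℕ} {C : ℝ} {tx : ℕ → ℝ} {S : Finset ℕ}
    (hC : 0 ≤ C) (htx : ∀ t ∈ Icc 1 n, 0 ≤ tx t) (hS : GFeasible F C n tx S)
    {u t : ℕ} (hut : t ≤ u + F) :
    valueBefore tx S (t + 1) ≤ valueBefore tx S u + C := by
  have hpos : ∀ x ∈ S, 0 ≤ tx x := fun x hx => htx x (hS.1 hx)
  have hwin : ∑ x ∈ S with u ≤ x ∧ x ≤ t, tx x ≤ C := by
    rcases (S.filter (fun x => u ≤ x ∧ x ≤ t)).eq_empty_or_nonempty with he | hne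
    · simpa [he] using hC
    · obtain ⟨w, hw, hmax⟩ := exists_max_image _ id hne
      refine le_trans (sum_le_sum_of_subset_of_nonneg ?_ ?_) (hS.2 w (mem_filter.1 hw).1)
      · intro x hx
        have h1 := hmax x hx
        simp only [mem_filter, id] at *
        exact ⟨hx.1, by omega, h1⟩
      · exact fun x hx _ => hpos x (mem_filter.1 hx).1
  have hsub : valueBefore tx S (t + 1) ≤
      ∑ x ∈ S.filter (fun x => x < u) ∪ S.filter (fun x => u ≤ x ∧ x ≤ t), tx x := by
    refine sum_le_sum_of_subset_of_nonneg ?_ ?_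
    · intro x hx
      simp only [mem_filter, mem_union] at *
      grind
    · intro x hx _
      simp only [mem_filter, mem_union] at hx
      exact hpos x (by tauto)
  rw [sum_union] at hsub
  · unfold valueBefore at *; linarith
  · rw [disjoint_left]; intro x; simp only [mem_filter]; grind

theorem add_mul_le_of_forall_add_le {V : ℕ → ℝ} {c : ℝ} {m : ℕ}
    (h : ∀ i < m, V i + c ≤ V (i + 1)) (i d : ℕ) (hd : i + d ≤ m) :
    V i + d * c ≤ V (i + d) := by
  induction d with
  | zero => simp
  | succ d ih =>
    have h1 := ih (by omega)
    have h2 := h (i + d) (by omega)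
    rw [← add_assoc]; push_cast; linarith

/-- The invariant of `FlushWhenFull` after time `n`, compared with a benchmark whose value
strictly before time `t` is `G t`: `f i` is the time of the `i`-th flush (counted from `1`) and
`V i` the value settled by then. A completed wallet use settles at least `c`, and the benchmark
stays `δ` below `R` times the algorithm at each flush. -/
structure FWFInvariant (C R c δ : ℝ) (k F : ℕ) (G : ℕ → ℝ) (n : ℕ) (st : FWFState)
    (f : ℕ → ℕ) (V : ℕ → ℝ) : Prop where
  offline : ∀ i < k, st.offlineUntil ((st.active + i) % k) =
    if k ≤ st.active + i then f (st.active + i + 1 - k) + F else 0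
  flush_bound : ∀ i, 1 ≤ i → i ≤ st.active → G (f i) + δ ≤ R * V i
  progress : ∀ i < st.active, V i + c ≤ V (i + 1)
  cap : st.cap = C / k - (st.settled - V st.active)
  settled_ge : V st.active ≤ st.settled
  bound : G (n + 1) ≤ R * V st.active + (st.settled - V st.active)

theorem FWFInvariant.step {C R c δ v : ℝ} {k F n : ℕ} {G : ℕ → ℝ} {st : FWFState}
    {f : ℕ → ℕ} {V : ℕ → ℝ} (hk : 1 ≤ k)
    (hc : (R - 1) * c = δ) (hR1 : 1 ≤ R) (hδ : C - δ ≤ R * ((k - 1) * c))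
    (hv : 0 ≤ v) (hvc : v ≤ C / k - c) (hvδ : v ≤ δ)
    (hwin : ∀ u t, t ≤ u + F → G (t + 1) ≤ G u + C) (hG : G (n + 1 + 1) ≤ G (n + 1) + v)
    (h : FWFInvariant C R c δ k F G n st f V) :
    ∃ f' V', FWFInvariant C R c δ k F G (n + 1) (fwfStep C k F st (n + 1) v) f' V' := by
  obtain ⟨hoff, hfl, hpr, hcap, hge, hb⟩ := h
  unfold fwfStep
  split_ifs with h1 h2
  · refine ⟨f, V, hoff, hfl, hpr, hcap, hge, ?_⟩
    have h0 := hoff 0 (by omega)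
    simp only [add_zero] at h0
    rw [h0] at h1
    split_ifs at h1 with hkm
    · have hw := hwin _ _ h1
      have hf := hfl (st.active + 1 - k) (by omega) (by omega)
      have ht := add_mul_le_of_forall_add_le hpr (st.active + 1 - k) (k - 1) (by omega)
      rw [show st.active + 1 - k + (k - 1) = st.active by omega, Nat.cast_sub hk] at ht
      push_cast at ht
      have := mul_le_mul_of_nonneg_left ht (zero_le_one.trans hR1)
      linarith
    · omega
  · refine ⟨f, V, hoff, hfl, hpr, ?_, ?_, ?_⟩ <;> dsimp only <;> linarith
  · have hD : c ≤ st.settled - V st.active := by linarith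
    have hRD := mul_le_mul_of_nonneg_left hD (sub_nonneg.2 hR1)
    refine ⟨Function.update f (st.active + 1) (n + 1),
      Function.update V (st.active + 1) st.settled, ?_, ?_, ?_, ?_, ?_, ?_⟩ <;> dsimp only
    · intro i hi
      rcases Nat.lt_or_ge (i + 1) k with hik | hik
      · have hne : (st.active + 1 + i) % k ≠ st.active % k := fun e => by
          have hd := (Nat.modEq_iff_dvd' (by omega)).1 (show st.active ≡ st.active + 1 + i [MOD k]
            from e.symm)
          have := Nat.le_of_dvd (by omega) hd
          omega
        have := hoff (i + 1) hik
        rw [if_neg hne, Function.update_of_ne (by omega),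
          show st.active + 1 + i = st.active + (i + 1) by omega, this]
      · have : st.active + 1 + i = st.active + k := by omega
        rw [this, if_pos (by simp), if_pos (by omega),
          show st.active + k + 1 - k = st.active + 1 by omega, Function.update_self]
    · intro i hi1 hi2
      rcases Nat.lt_or_ge st.active i with hi | hi
      · obtain rfl : i = st.active + 1 := by omega
        simp only [Function.update_self]
        linarith
      · rw [Function.update_of_ne (by omega), Function.update_of_ne (by omega)]
        exact hfl i hi1 hi
    · intro i hi
      rcases Nat.lt_or_ge i st.active with hi' | hi'
      · rw [Function.update_of_ne (by omega), Function.update_of_ne (by omega)]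
        exact hpr i hi'
      · obtain rfl : i = st.active := by omega
        rw [Function.update_of_ne (by omega), Function.update_self]
        linarith
    · simp
    · simp
    · simp only [Function.update_self]
      linarith

theorem fwfRun_succ (C : ℝ) (k F n : ℕ) (tx : ℕ → ℝ) :
    fwfRun C k F (n + 1) tx = fwfStep C k F (fwfRun C k F n tx) (n + 1) (tx (n + 1)) := by
  simp [fwfRun, List.range_succ]

/-- `FlushWhenFull` (run with `k` wallets of size `C / k`) is
`(k+1)/(k(1 − r))`-competitive even against the optimal policy of the *general*
collateral model: every feasible settled set of the general model settles at most
`(k+1)/(k(1 − r)) · V_FWF(tx)`. -/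
theorem fwf_competitive_general (C T : ℝ) (k F : ℕ)
    (hC : 0 < C) (hT : 0 < T) (hk : 2 ≤ k) (hF : 1 ≤ F)
    (hr : (k : ℝ) * T / C < 1) :
    ∀ (n : ℕ) (tx : ℕ → ℝ),
      (∀ t ∈ Finset.Icc 1 n, 0 ≤ tx t ∧ tx t ≤ T) →
      ∀ S : Finset ℕ, GFeasible F C n tx S →
        GValue tx S ≤
          (((k : ℝ) + 1) / ((k : ℝ) * (1 - (k : ℝ) * T / C))) * VFWF C k F n tx := by
  intro n tx htx S hS
  have hk0 : (0 : ℝ) < k := by exact_mod_cast (by omega : 0 < k)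
  have hkT : (k : ℝ) * T < C := by rwa [div_lt_one hC] at hr
  set c := C / k - T with hcdef
  set R := ((k : ℝ) + 1) / ((k : ℝ) * (1 - (k : ℝ) * T / C)) with hRdef
  have hRc : R * c = (k + 1) * C / k ^ 2 := by
    have : C - k * T ≠ 0 := (sub_pos.2 hkT).ne'
    rw [hRdef, hcdef]
    field_simp
  have hR1 : 1 ≤ R := by
    rw [hRdef, le_div_iff₀ (mul_pos hk0 (sub_pos.2 hr))]
    have : 0 ≤ (k : ℝ) * (k * T / C) := by positivity
    linarith
  have hRc' : (R - 1) * c = C / k ^ 2 + T := by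
    rw [sub_mul, hRc, hcdef]; field_simp; ring
  have hδ : C - (C / k ^ 2 + T) ≤ R * ((k - 1) * c) := by
    have : R * ((k - 1) * c) = C - C / k ^ 2 := by
      rw [mul_left_comm, hRc]; field_simp; ring
    linarith
  have hinv : ∀ m ≤ n, ∃ f V, FWFInvariant C R c (C / k ^ 2 + T) k F (valueBefore tx S) m
      (fwfRun C k F m tx) f V := by
    intro m
    induction m with
    | zero =>
      intro _
      have h0 : valueBefore tx S 1 = 0 := by
        refine sum_eq_zero fun x hx => ?_
        have := mem_Icc.1 (hS.1 (mem_filter.1 hx).1)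
        have := (mem_filter.1 hx).2
        omega
      refine ⟨fun _ => 0, fun _ => 0, ?_, ?_, ?_, ?_, ?_, ?_⟩ <;> simp [fwfRun, h0]
      all_goals intros; omega
    | succ m ih =>
      intro hm
      obtain ⟨f, V, h⟩ := ih (by omega)
      obtain ⟨hv0, hvT⟩ := htx (m + 1) (mem_Icc.2 ⟨by omega, hm⟩)
      rw [fwfRun_succ]
      refine h.step (by omega) hRc' hR1 hδ hv0 (by linarith) ?_
        (fun u t hut => hS.valueBefore_window_le hC.le (fun t ht => (htx t ht).1) hut)
        (valueBefore_succ_le hv0 S)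
      have : 0 ≤ C / (k : ℝ) ^ 2 := by positivity
      linarith
  obtain ⟨f, V, h⟩ := hinv n le_rfl
  have hG : GValue tx S = valueBefore tx S (n + 1) := by
    rw [GValue, valueBefore, filter_true_of_mem]
    exact fun x hx => Nat.lt_succ_of_le (mem_Icc.1 (hS.1 hx)).2
  rw [hG, VFWF]
  have h1 := h.bound
  have h2 := mul_nonneg (sub_nonneg.2 hR1) (sub_nonneg.2 h.settled_ge)
  linarith
end

section
/- (Value bound for the threshold algorithm A_η against the general-model optimum.) Let C > 0 and T ≥ 0 be reals, F ≥ 1 an integer flush period, and let η be a real with T/C ≤ η ≤ 1 and η + T/C < 1. Then for every n and every transaction sequence tx of length n with maximum transaction size T, OPT_G(C;tx) ≤ (C/(C − ηC − T)) · V_{A_η}(tx). -/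
open Finset

theorem etaRun_succ (C η : ℝ) (F m : ℕ) (tx : ℕ → ℝ) :
    etaRun C η F (m + 1) tx = etaStep C η F (etaRun C η F m tx) (m + 1) (tx (m + 1)) := by
  simp [etaRun, List.range_succ]

theorem etaStep_ret_of_ne (C η : ℝ) (F : ℕ) (st : EtaState) (t : ℕ) (v : ℝ) {u : ℕ}
    (hu : u ≠ t + F + 1) : (etaStep C η F st t v).ret u = st.ret u := by
  unfold etaStep
  dsimp only
  split_ifs <;> simp [hu]

theorem etaStep_avail_add_settled (C η : ℝ) (F : ℕ) (st : EtaState) (t : ℕ) (v : ℝ) :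
    (etaStep C η F st t v).avail + (etaStep C η F st t v).settled =
      st.avail + st.settled + st.ret t := by
  unfold etaStep
  dsimp only
  split_ifs <;> dsimp only <;> ring

theorem etaStep_settled_sub_committed (C η : ℝ) (F : ℕ) (st : EtaState) (t : ℕ) (v : ℝ) :
    (etaStep C η F st t v).settled - (etaStep C η F st t v).committed =
      st.settled - st.committed +
        ((etaStep C η F st t v).ret (t + F + 1) - st.ret (t + F + 1)) := by
  unfold etaStep
  dsimp only
  split_ifs <;> simp
  ring

theorem etaStep_committed_le {C η : ℝ} (F : ℕ) {st : EtaState} (t : ℕ) {v : ℝ}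
    (hst : st.committed ≤ η * C) (hv : v ≤ η * C) :
    (etaStep C η F st t v).committed ≤ η * C := by
  unfold etaStep
  dsimp only
  split_ifs <;> dsimp only <;> linarith

theorem etaStep_settled_of_le (C η : ℝ) (F : ℕ) {st : EtaState} {t : ℕ} {v : ℝ}
    (h : v ≤ st.avail + st.ret t) :
    (etaStep C η F st t v).settled = st.settled + v := by
  unfold etaStep
  dsimp only
  split_ifs <;> rfl

theorem etaStep_settled_of_lt (C η : ℝ) (F : ℕ) {st : EtaState} {t : ℕ} {v : ℝ}
    (h : st.avail + st.ret t < v) :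
    (etaStep C η F st t v).settled = st.settled := by
  simp [etaStep, not_le.mpr h]

theorem etaRun_ret_eq_zero (C η : ℝ) (F m : ℕ) (tx : ℕ → ℝ) {u : ℕ} (hu : m + F + 1 < u) :
    (etaRun C η F m tx).ret u = 0 := by
  induction m with
  | zero => rfl
  | succ m ih =>
    rw [etaRun_succ, etaStep_ret_of_ne _ _ _ _ _ _ (by omega), ih (by omega)]

theorem etaRun_ret_eq_of_le (C η : ℝ) (F : ℕ) (tx : ℕ → ℝ) {p m u : ℕ} (hpm : p ≤ m)
    (hu : u ≤ p + F + 1) : (etaRun C η F m tx).ret u = (etaRun C η F p tx).ret u := by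
  induction m, hpm using Nat.le_induction with
  | base => rfl
  | succ m hm ih =>
    rw [etaRun_succ, etaStep_ret_of_ne _ _ _ _ _ _ (by omega), ih]

theorem etaRun_avail_add_settled (C η : ℝ) (F m : ℕ) (tx : ℕ → ℝ) :
    (etaRun C η F m tx).avail + (etaRun C η F m tx).settled =
      C + ∑ u ∈ Finset.range (m + 1), (etaRun C η F m tx).ret u := by
  induction m with
  | zero => simp [etaRun]
  | succ m ih =>
    have hret : ∑ u ∈ Finset.range (m + 2), (etaRun C η F (m + 1) tx).ret u =
        ∑ u ∈ Finset.range (m + 2), (etaRun C η F m tx).ret u :=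
      Finset.sum_congr rfl fun u hu =>
        etaRun_ret_eq_of_le C η F tx m.le_succ (by rw [Finset.mem_range] at hu; omega)
    rw [hret, Finset.sum_range_succ, etaRun_succ, etaStep_avail_add_settled, ih, add_assoc]

theorem etaRun_settled_sub_committed (C η : ℝ) (F m : ℕ) (tx : ℕ → ℝ) :
    (etaRun C η F m tx).settled - (etaRun C η F m tx).committed =
      ∑ u ∈ Finset.range (m + F + 2), (etaRun C η F m tx).ret u := by
  induction m with
  | zero => simp [etaRun]
  | succ m ih =>
    have hret : ∑ u ∈ Finset.range (m + F + 2), (etaRun C η F (m + 1) tx).ret u =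
        ∑ u ∈ Finset.range (m + F + 2), (etaRun C η F m tx).ret u :=
      Finset.sum_congr rfl fun u hu =>
        etaRun_ret_eq_of_le C η F tx m.le_succ (by rw [Finset.mem_range] at hu; omega)
    have hzero := etaRun_ret_eq_zero C η F m tx (u := m + 1 + F + 1) (by omega)
    rw [show m + 1 + F + 2 = m + F + 2 + 1 by ring, Finset.sum_range_succ, hret, ← ih,
      etaRun_succ, etaStep_settled_sub_committed, hzero, sub_zero,
      show m + F + 2 = m + 1 + F + 1 by ring]

theorem etaRun_committed_le {C η : ℝ} (F : ℕ) {n : ℕ} {tx : ℕ → ℝ} (hη : 0 ≤ η * C)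
    (htx : ∀ t ∈ Finset.Icc 1 n, tx t ≤ η * C) {m : ℕ} (hm : m ≤ n) :
    (etaRun C η F m tx).committed ≤ η * C := by
  induction m with
  | zero => simpa [etaRun] using hη
  | succ m ih =>
    rw [etaRun_succ]
    exact etaStep_committed_le F _ (ih (by omega)) (htx _ (Finset.mem_Icc.mpr (by omega)))

/-- The collateral available to the transaction in slot `m + 1` is `C`, minus the value settled
in slots `m + 1 - F, …, m`, minus the value already committed but unflushed before them. -/
theorem etaRun_avail_add_ret (C η : ℝ) (F m : ℕ) (tx : ℕ → ℝ) :
    (etaRun C η F m tx).avail + (etaRun C η F m tx).ret (m + 1) =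
      C - ((etaRun C η F m tx).settled - (etaRun C η F (m - F) tx).settled) -
        (etaRun C η F (m - F) tx).committed := by
  have hsum : ∑ u ∈ Finset.range (m + 2), (etaRun C η F m tx).ret u =
      ∑ u ∈ Finset.range (m - F + F + 2), (etaRun C η F (m - F) tx).ret u := by
    rw [Finset.sum_congr rfl fun u hu => etaRun_ret_eq_of_le C η F tx (Nat.sub_le m F)
      (by rw [Finset.mem_range] at hu; omega)]
    rcases le_total F m with h | h
    · rw [Nat.sub_add_cancel h]
    · have hp : m - F = 0 := by omega
      simp [hp, etaRun]
  have h₁ := etaRun_avail_add_settled C η F m tx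
  have h₂ := etaRun_settled_sub_committed C η F (m - F) tx
  rw [Finset.sum_range_succ] at hsum
  linarith

theorem GFeasible.sum_window_le {F : ℕ} {C : ℝ} {n : ℕ} {tx : ℕ → ℝ} {S : Finset ℕ}
    (hS : GFeasible F C n tx S) (hC : 0 ≤ C) (htx : ∀ t ∈ S, 0 ≤ tx t) (m : ℕ) :
    ∑ t ∈ S with m - F ≤ t ∧ t ≤ m, tx t ≤ C := by
  rcases (S.filter fun t => m - F ≤ t ∧ t ≤ m).eq_empty_or_nonempty with h | h
  · rwa [h, Finset.sum_empty]
  · obtain ⟨hlast, hmem⟩ := Finset.mem_filter.mp (Finset.max'_mem _ h)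
    refine (Finset.sum_le_sum_of_subset_of_nonneg (fun t ht => ?_) fun t ht _ =>
      htx t (Finset.mem_filter.mp ht).1).trans (hS.2 _ hlast)
    have hle := Finset.le_max' _ t ht
    rw [Finset.mem_filter] at ht ⊢
    exact ⟨ht.1, by omega, hle⟩

/-- Value bound for the threshold algorithm `A_η` against the
general-model optimum: every feasible settled set of the general model settles at most
`C/(C − ηC − T) · V_{A_η}(tx)`. -/
theorem eta_value_bound (C T η : ℝ) (F : ℕ)
    (hC : 0 < C) (hT : 0 ≤ T) (hF : 1 ≤ F)
    (hη₁ : T / C ≤ η) (hη₂ : η ≤ 1) (hη₃ : η + T / C < 1) :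
    ∀ (n : ℕ) (tx : ℕ → ℝ),
      (∀ t ∈ Finset.Icc 1 n, 0 ≤ tx t ∧ tx t ≤ T) →
      ∀ S : Finset ℕ, GFeasible F C n tx S →
        GValue tx S ≤ (C / (C - η * C - T)) * VEta C η F n tx := by
  intro n tx htx S hS
  have hTη : T ≤ η * C := (div_le_iff₀ hC).mp hη₁
  have hD : 0 < C - η * C - T := by
    have h := mul_lt_mul_of_pos_right hη₃ hC
    rw [add_mul, div_mul_cancel₀ _ hC.ne'] at h
    linarith
  set c := C / (C - η * C - T)
  have hc₁ : 1 ≤ c := (one_le_div hD).mpr (by linarith)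
  have hcD : c * (C - η * C - T) = C := div_mul_cancel₀ _ hD.ne'
  have hpos : ∀ t ∈ S, 0 ≤ tx t := fun t ht => (htx t (hS.1 ht)).1
  have key : ∀ m ≤ n, ∑ t ∈ S with t ≤ m, tx t ≤ c * (etaRun C η F m tx).settled := by
    intro m
    induction m using Nat.strong_induction_on with
    | _ m ih =>
    intro hm
    rcases m with _ | m
    · rw [Finset.filter_false_of_mem fun t ht => by
        have := Finset.mem_Icc.mp (hS.1 ht); omega]
      simp [etaRun]
    obtain ⟨hv₀, hvT⟩ := htx (m + 1) (Finset.mem_Icc.mpr (by omega))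
    rcases le_or_gt (tx (m + 1))
      ((etaRun C η F m tx).avail + (etaRun C η F m tx).ret (m + 1)) with h | h
    · rw [etaRun_succ, etaStep_settled_of_le C η F h]
      have hsplit : ∑ t ∈ S with t ≤ m + 1, tx t ≤ ∑ t ∈ S with t ≤ m, tx t + tx (m + 1) := by
        rw [add_comm (∑ t ∈ S with t ≤ m, tx t),
          ← Finset.sum_insert (s := S.filter (· ≤ m)) (a := m + 1) (by simp)]
        refine Finset.sum_le_sum_of_subset_of_nonneg (fun t ht => ?_) fun t ht _ => ?_
        · simp only [Finset.mem_filter, Finset.mem_insert] at ht ⊢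
          have : t = m + 1 ∨ t ≤ m := by omega
          tauto
        · rcases Finset.mem_insert.mp ht with rfl | ht
          · exact hv₀
          · exact hpos t (Finset.mem_filter.mp ht).1
      have hprev := ih m m.lt_succ_self (by omega)
      nlinarith
    · rw [etaRun_succ, etaStep_settled_of_lt C η F h]
      have hsplit : ∑ t ∈ S with t ≤ m + 1, tx t ≤ ∑ t ∈ S with t ≤ m - F, tx t +
          ∑ t ∈ S with m + 1 - F ≤ t ∧ t ≤ m + 1, tx t := by
        rw [← Finset.sum_filter_add_sum_filter_not (S.filter (· ≤ m + 1)) (· ≤ m - F)]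
        refine add_le_add ?_ ?_ <;>
          refine Finset.sum_le_sum_of_subset_of_nonneg (fun t ht => ?_) fun t ht _ =>
            hpos t (Finset.mem_filter.mp ht).1
        · simp only [Finset.mem_filter] at ht ⊢
          exact ⟨ht.1.1, ht.2⟩
        · simp only [Finset.mem_filter] at ht ⊢
          exact ⟨ht.1.1, by omega, ht.1.2⟩
      have hprev := ih (m - F) (by omega) (by omega)
      have hwindow := hS.sum_window_le hC.le hpos (m + 1)
      have hR := etaRun_committed_le F (hT.trans hTη) (fun t ht => (htx t ht).2.trans hTη)
        (show m - F ≤ n by omega)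
      rw [etaRun_avail_add_ret] at h
      have hgain : C - η * C - T ≤
          (etaRun C η F m tx).settled - (etaRun C η F (m - F) tx).settled := by linarith
      have hgain' := mul_le_mul_of_nonneg_left hgain (zero_le_one.trans hc₁)
      rw [hcD, mul_sub] at hgain'
      linarith
  have hall : S.filter (· ≤ n) = S :=
    Finset.filter_true_of_mem fun t ht => (Finset.mem_Icc.mp (hS.1 ht)).2
  simpa only [GValue, VEta, hall] using key n le_rfl
end
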